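/- Let p ≥ 2, α = p−1 and θ ≥ 0. There exists a constant C = C(α,θ) > 0 such that for every μ with 0 ≤ μ < μ_{α,θ} one has TMSC(μ,α,θ) ≤ C / (1 − (μ/μ_{α,θ})^{p−1}). -/

import Mathlib

open MeasureTheory Real Filter ENNReal

/-- The fractional-dimension spherical volume constant `ω_θ = 2π^((θ+1)/2)/Γ((θ+1)/2)`. -/
noncomputable def omegaW (θ : ℝ) : ℝ := 2 * Real.pi ^ ((θ + 1) / 2) / Real.Gamma ((θ + 1) / 2)

/-- Weighted integral `∫₀^∞ f dλ_θ = ω_θ ∫₀^∞ f(r) r^θ dr` (for nonnegative integrands,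
valued in `ℝ≥0∞`). -/
noncomputable def wInt (θ : ℝ) (f : ℝ → ℝ) : ℝ≥0∞ :=
  ENNReal.ofReal (omegaW θ) *
    ∫⁻ r in Set.Ioi (0 : ℝ), ENNReal.ofReal (f r) * ENNReal.ofReal (r ^ θ)

/-- The weighted Lebesgue norm `‖u‖_{L^q_θ}` (valued in `ℝ≥0∞`). -/
noncomputable def wNorm (θ q : ℝ) (u : ℝ → ℝ) : ℝ≥0∞ :=
  (wInt θ fun r => |u r| ^ q) ^ (1 / q)

/-- Membership in the weighted Sobolev space `X = X^{1,p}_∞(α,θ)`: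
`u` is locally absolutely continuous on `(0,∞)` with a.e. derivative `u'`
(expressed through the fundamental theorem of calculus on compact subintervals),
`u(r) → 0` as `r → ∞`, `‖u‖_{L^p_θ} < ∞` and `‖u'‖_{L^p_α} < ∞`. -/
structure MemX (p α θ : ℝ) (u u' : ℝ → ℝ) : Prop where
  ftc_int : ∀ a b : ℝ, 0 < a → a ≤ b → IntervalIntegrable u' MeasureTheory.volume a b
  ftc : ∀ a b : ℝ, 0 < a → a ≤ b → u b - u a = ∫ t in a..b, u' t
  lim_zero : Filter.Tendsto u Filter.atTop (nhds 0)
  fin_u : wNorm θ p u < ⊤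
  fin_u' : wNorm α p u' < ⊤

/-- Full norm on `X`: `‖u‖ = (‖u‖_{L^p_θ}^p + ‖u'‖_{L^p_α}^p)^{1/p}`. -/
noncomputable def Xnorm (p α θ : ℝ) (u u' : ℝ → ℝ) : ℝ≥0∞ :=
  ((wNorm θ p u) ^ p + (wNorm α p u') ^ p) ^ (1 / p)

/-- The truncated exponential `φ_p(t) = Σ_{j ∈ ℕ, j ≥ p-1} t^j / j!`. -/
noncomputable def phiP (p t : ℝ) : ℝ :=
  ∑' j : ℕ, if p - 1 ≤ (j : ℝ) then t ^ j / (Nat.factorial j : ℝ) else 0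

/-- The critical constant `μ_{α,θ} = (θ+1) ω_α^{1/α}`. -/
noncomputable def muC (α θ : ℝ) : ℝ := (θ + 1) * (omegaW α) ^ (1 / α)

/-- The Trudinger–Moser functional `∫₀^∞ φ_p(μ |u|^{p/(p-1)}) dλ_θ`. -/
noncomputable def TMfunc (p θ μ : ℝ) (u : ℝ → ℝ) : ℝ≥0∞ :=
  wInt θ fun r => phiP p (μ * |u r| ^ (p / (p - 1)))

/-- The subcritical Trudinger–Moser supremum
`TMSC(μ,α,θ) = sup { ‖u‖_{L^p_θ}^{-p} ∫₀^∞ φ_p(μ|u|^{p/(p-1)}) dλ_θ : u ∈ X, u ≠ 0, ‖u'‖_{L^p_α} ≤ 1 }`. -/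
noncomputable def TMSC (p α θ μ : ℝ) : ℝ≥0∞ :=
  ⨆ (u : ℝ → ℝ) (u' : ℝ → ℝ) (_ : MemX p α θ u u') (_ : u ≠ 0)
    (_ : wNorm α p u' ≤ 1), (wNorm θ p u) ^ (-p) * TMfunc p θ μ u

/-- The critical Trudinger–Moser supremum
`TMC(σ,α,θ) = sup { ∫₀^∞ φ_p(σ|u|^{p/(p-1)}) dλ_θ : u ∈ X, ‖u‖ ≤ 1 }`. -/
noncomputable def TMC (p α θ σ : ℝ) : ℝ≥0∞ :=
  ⨆ (u : ℝ → ℝ) (u' : ℝ → ℝ) (_ : MemX p α θ u u') (_ : Xnorm p α θ u u' ≤ 1),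
    TMfunc p θ σ u

/-- `k₀ = min { j ∈ ℕ : j ≥ p - 1 }`. -/
noncomputable def k0 (p : ℝ) : ℕ := sInf {j : ℕ | p - 1 ≤ (j : ℝ)}

/-- `TMC(σ,α,θ)` is attained by some `u ∈ X` with `‖u‖ ≤ 1`. -/
def TMCAttained (p α θ σ : ℝ) : Prop :=
  ∃ u u' : ℝ → ℝ, MemX p α θ u u' ∧ Xnorm p α θ u u' ≤ 1 ∧
    TMC p α θ σ = TMfunc p θ σ u

/-- `σ_* = inf { σ ∈ (0, μ_{α,θ}) : TMC(σ,α,θ) is attained }`. -/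
noncomputable def sigmaStar (p α θ : ℝ) : ℝ :=
  sInf {σ : ℝ | σ ∈ Set.Ioo 0 (muC α θ) ∧ TMCAttained p α θ σ}

open Set in
theorem AbsolutelyContinuousOnInterval.comp_contDiffOn {f g : ℝ → ℝ} {a b c d : ℝ}
    (hf : AbsolutelyContinuousOnInterval f a b) (hg : ContDiffOn ℝ 1 g (Icc c d))
    (hmaps : MapsTo f (uIcc a b) (Icc c d)) :
    AbsolutelyContinuousOnInterval (fun x => g (f x)) a b := by
  obtain ⟨K, hK⟩ := hg.exists_lipschitzOnWith (by decide) (convex_Icc _ _) isCompact_Icc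
  rw [absolutelyContinuousOnInterval_iff] at hf ⊢
  intro ε hε
  obtain ⟨δ, hδ, h⟩ := hf (ε / (K + 1)) (by positivity)
  refine ⟨δ, hδ, fun P hP hlt => ?_⟩
  have hmem : ∀ i ∈ Finset.range P.1, (P.2 i).1 ∈ uIcc a b ∧ (P.2 i).2 ∈ uIcc a b := hP.1
  calc ∑ i ∈ Finset.range P.1, dist (g (f (P.2 i).1)) (g (f (P.2 i).2))
      ≤ ∑ i ∈ Finset.range P.1, (K + 1) * dist (f (P.2 i).1) (f (P.2 i).2) := by
        refine Finset.sum_le_sum fun i hi => ?_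
        refine (hK.dist_le_mul _ (hmaps (hmem i hi).1) _ (hmaps (hmem i hi).2)).trans ?_
        gcongr
        simp
    _ = (K + 1) * ∑ i ∈ Finset.range P.1, dist (f (P.2 i).1) (f (P.2 i).2) := by
        rw [Finset.mul_sum]
    _ < (K + 1) * (ε / (K + 1)) := by
        have : (0 : ℝ) < K + 1 := by positivity
        exact mul_lt_mul_of_pos_left (h P hP hlt) this
    _ = ε := by field_simp

theorem AbsolutelyContinuousOnInterval.comp_contDiff {f g : ℝ → ℝ} {a b : ℝ}
    (hf : AbsolutelyContinuousOnInterval f a b) (hg : ContDiff ℝ 1 g) :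
    AbsolutelyContinuousOnInterval (fun x => g (f x)) a b := by
  obtain ⟨C, hC⟩ := hf.exists_bound
  exact hf.comp_contDiffOn (c := -C) (d := C) hg.contDiffOn fun x hx => abs_le.1 (hC x hx)

/-- A function with a.e. derivative bounded below grows at least by the integral of the bound. -/
theorem AbsolutelyContinuousOnInterval.integral_le_sub {f h : ℝ → ℝ} {a b : ℝ} (hab : a ≤ b)
    (hf : AbsolutelyContinuousOnInterval f a b) (hh : IntervalIntegrable h volume a b)
    (hle : ∀ᵐ x, x ∈ Set.Icc a b → ∃ d, HasDerivAt f d x ∧ h x ≤ d) :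
    ∫ x in a..b, h x ≤ f b - f a := by
  rw [← hf.integral_deriv_eq_sub]
  refine intervalIntegral.integral_mono_ae_restrict hab hh hf.intervalIntegrable_deriv ?_
  rw [EventuallyLE, ae_restrict_iff' measurableSet_Icc]
  filter_upwards [hle] with x hx hmem
  obtain ⟨d, hd, hle⟩ := hx hmem
  rwa [hd.deriv]

/-- The defect in Young's inequality for the exponents `p` and `1 + β`, `β = 1 / (p - 1)`. -/
noncomputable def youngDefect (p β y : ℝ) : ℝ := 1 - (1 + β) * y + β * |y| ^ p

theorem youngDefect_nonneg {p β : ℝ} (hp : 1 ≤ p) (hβ : 0 < β) (h : β * p = 1 + β) (y : ℝ) :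
    0 ≤ youngDefect p β y := by
  unfold youngDefect
  rcases le_total 0 y with hy | hy
  · have := one_add_mul_self_le_rpow_one_add (s := y - 1) (by linarith) hp
    rw [abs_of_nonneg hy]
    rw [show 1 + (y - 1) = y by ring] at this
    have h2 := mul_le_mul_of_nonneg_left this hβ.le
    nlinarith
  · have : 0 ≤ β * |y| ^ p := by positivity
    nlinarith

theorem one_sub_le_youngDefect {p β : ℝ} (hβ : 0 < β) (y : ℝ) :
    1 - (1 + β) * y ≤ youngDefect p β y := by
  have : 0 ≤ β * |y| ^ p := by positivity
  unfold youngDefect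
  linarith

theorem exists_pos_le_youngDefect {p β : ℝ} (hp : 1 < p) (hβ : 0 < β) (h : β * p = 1 + β)
    {z : ℝ} (hz : 0 < z) (hz1 : z < 1) :
    ∃ c > 0, ∀ y, 0 ≤ y → y ≤ z → c ≤ youngDefect p β y := by
  refine ⟨youngDefect p β z, ?_, fun y hy hyz => ?_⟩
  · have := one_add_mul_self_lt_rpow_one_add (s := z - 1) (by linarith) (by linarith) hp
    rw [show 1 + (z - 1) = z by ring] at this
    have h2 := mul_lt_mul_of_pos_left this hβ
    rw [youngDefect, abs_of_pos hz]
    nlinarith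
  · have h1 := one_add_mul_self_le_rpow_one_add (s := y / z - 1)
      (by have : 0 ≤ y / z := by positivity
          linarith) hp.le
    rw [show 1 + (y / z - 1) = y / z by ring, div_rpow hy hz.le, le_div_iff₀ (by positivity)] at h1
    have h2 : z ^ p ≤ z := by
      simpa using rpow_le_rpow_of_exponent_ge hz hz1.le hp.le
    have h3 : (1 + p * (y / z - 1)) * z ^ p = z ^ p - p * (z - y) * (z ^ p / z) := by
      field_simp
      ring
    have h4 : z ^ p / z ≤ 1 := (div_le_one hz).2 h2
    rw [h3] at h1
    have h5 : p * (z - y) * (z ^ p / z) ≤ p * (z - y) * 1 := by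
      have : 0 ≤ p * (z - y) := mul_nonneg (by linarith) (by linarith)
      gcongr
    rw [youngDefect, youngDefect, abs_of_pos hz, abs_of_nonneg hy]
    nlinarith

/-- Critical Moser-type differential inequality for a combination of three exponentials. -/
theorem exists_moser_supersolution {p β : ℝ} (hp : 1 < p) (hβ : 0 < β) (h : β * p = 1 + β) :
    ∃ A B D κ : ℝ, 0 ≤ B ∧ B ≤ A ∧ 0 ≤ D ∧ 0 ≤ κ ∧ κ ≤ 1 ∧
      ∀ X e m y : ℝ, 0 ≤ m → 0 < e → e ≤ 1 → X = m * e →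
        exp X ≤ A * exp m * youngDefect p β y
          + D * exp (κ * m) * (1 - κ * (1 - youngDefect p β y))
          + B * exp X * ((1 + β) * e * y - 1) := by
  set z : ℝ := (1 + β / 4) / (1 + β / 2) with hz
  have hz0 : 0 < z := by positivity
  have hz1 : z < 1 := by rw [hz, div_lt_one (by positivity)]; linarith
  obtain ⟨c, hc, hcy⟩ := exists_pos_le_youngDefect hp hβ h hz0 hz1
  set κ : ℝ := (1 + β / 2) / (1 + β) with hκ
  have hκ0 : 0 < κ := by positivity
  have hκ1 : κ < 1 := by rw [hκ, div_lt_one (by positivity)]; linarith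
  set B : ℝ := 4 / β with hB
  have hB0 : 0 < B := by positivity
  have hκ1' : 0 < 1 - κ := by linarith
  refine ⟨(2 * B + 1) + (B + 1) / c, B, (B + 1) / (1 - κ), κ, hB0.le, ?_, by positivity, hκ0.le,
    hκ1.le, ?_⟩
  · have : 0 < (B + 1) / c := by positivity
    linarith
  intro X e m y hm he he1 hX
  have hn := youngDefect_nonneg hp.le hβ h y
  set n := youngDefect p β y with hndef
  have hXm : exp X ≤ exp m := exp_le_exp.2 (by rw [hX]; nlinarith)
  have hD0 : 0 ≤ (B + 1) / (1 - κ) * exp (κ * m) * (1 - κ * (1 - n)) := by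
    have : 0 ≤ 1 - κ * (1 - n) := by nlinarith
    positivity
  have hA1 : 0 ≤ (2 * B + 1) * exp m * n := by positivity
  have hA2 : 0 ≤ (B + 1) / c * exp m * n := by positivity
  have hEX := exp_pos X
  rw [add_mul, add_mul]
  rcases le_total y 0 with hy | hy
  · have h1 : 1 - (1 + β) * y ≤ n := one_sub_le_youngDefect hβ y
    have h2 : (2 * B + 1) * exp X * (1 - (1 + β) * y) ≤ (2 * B + 1) * exp m * n := by
      have : 0 ≤ 1 - (1 + β) * y := by nlinarith
      gcongr
    have h3 : (1 + β) * y ≤ (1 + β) * e * y := by nlinarith [mul_nonneg hβ.le (neg_nonneg.2 hy)]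
    have h4 : B * exp X * ((1 + β) * y - 1) ≤ B * exp X * ((1 + β) * e * y - 1) := by
      gcongr
    have h5 : 0 ≤ -((1 + β) * y) := by nlinarith
    have h6 : 0 ≤ (B + 1) * exp X * (-((1 + β) * y)) := by positivity
    nlinarith
  have hBy : -(B * exp X) ≤ B * exp X * ((1 + β) * e * y - 1) := by
    have : 0 ≤ B * exp X * ((1 + β) * e * y) := by positivity
    linarith
  rcases le_or_gt e κ with hek | hek
  · have h1 : exp X ≤ exp (κ * m) := exp_le_exp.2 (by rw [hX]; nlinarith)
    have h2 : (B + 1) * exp X ≤ (B + 1) / (1 - κ) * exp (κ * m) * (1 - κ * (1 - n)) := by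
      calc (B + 1) * exp X ≤ (B + 1) * exp (κ * m) := by gcongr
        _ = (B + 1) / (1 - κ) * exp (κ * m) * (1 - κ) := by field_simp
        _ ≤ _ := by
          gcongr
          nlinarith
    linarith
  rcases le_or_gt (1 + β / 4) ((1 + β) * e * y) with hey | hey
  · have : B * exp X * (β / 4) ≤ B * exp X * ((1 + β) * e * y - 1) := by
      gcongr
      linarith
    have h2 : B * exp X * (β / 4) = exp X := by rw [hB]; field_simp
    linarith
  · have hyz : y ≤ z := by
      rw [hz, le_div_iff₀ (by positivity)]
      have h1 : 1 + β / 2 ≤ (1 + β) * e := by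
        rw [hκ, div_lt_iff₀ (by positivity)] at hek
        linarith
      nlinarith
    have h2 : (B + 1) * exp X ≤ (B + 1) / c * exp m * n := by
      calc (B + 1) * exp X ≤ (B + 1) * exp m := by gcongr
        _ = (B + 1) / c * exp m * c := by field_simp
        _ ≤ _ := by
          gcongr
          exact hcy y hy hyz
    linarith

theorem exists_contDiff_cutoff :
    ∃ (χ χ' : ℝ → ℝ) (K : ℝ), ContDiff ℝ 1 χ ∧ (∀ m, HasDerivAt χ (χ' m) m) ∧ (∀ m, 0 ≤ χ m) ∧
      (∀ m, 0 ≤ χ' m) ∧ (∀ m ≤ 1, χ m = 0 ∧ χ' m = 0) ∧ (∀ m, 2 ≤ m → χ m = 1 ∧ χ' m = 0) ∧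
      ∀ m ∈ Set.Icc (1 : ℝ) 2, χ' m ≤ K := by
  set χ : ℝ → ℝ := fun m => smoothTransition (m - 1) with hχ
  have hsm : ContDiff ℝ 1 χ :=
    (smoothTransition.contDiff (n := 1)).comp (contDiff_id.sub contDiff_const)
  have hmono : Monotone χ := fun x y hxy => smoothTransition.monotone (by linarith)
  have h0 : ∀ m ≤ 1, χ m = 0 := fun m hm => smoothTransition.zero_of_nonpos (by linarith)
  have h1 : ∀ m, 2 ≤ m → χ m = 1 := fun m hm => smoothTransition.one_of_one_le (by linarith)
  obtain ⟨K, hK⟩ := (isCompact_Icc (a := (1 : ℝ)) (b := 2)).exists_bound_of_continuousOn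
    (hsm.continuous_deriv le_rfl).continuousOn
  refine ⟨χ, deriv χ, K, hsm, fun m => (hsm.differentiable (by simp) m).hasDerivAt,
    fun m => smoothTransition.nonneg _, fun m => hmono.deriv_nonneg, fun m hm => ⟨h0 m hm, ?_⟩,
    fun m hm => ⟨h1 m hm, ?_⟩, fun m hm => (le_abs_self _).trans (hK m hm)⟩
  · refine IsLocalMin.deriv_eq_zero (Eventually.of_forall fun x => ?_)
    rw [h0 m hm]
    exact smoothTransition.nonneg _
  · refine IsLocalMax.deriv_eq_zero (Eventually.of_forall fun x => ?_)
    rw [h1 m hm]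
    exact smoothTransition.le_one _

/-- The supersolution `G m - H m * exp X`, which vanishes for `m ≤ 1`, used to bound the
Trudinger–Moser functional. -/
theorem exists_cutoff_moser_supersolution {p β : ℝ} (hp : 1 < p) (hβ : 0 < β)
    (h : β * p = 1 + β) :
    ∃ (G G' H H' : ℝ → ℝ) (C : ℝ), 0 < C ∧ ContDiff ℝ 1 G ∧ ContDiff ℝ 1 H ∧
      (∀ m, HasDerivAt G (G' m) m) ∧ (∀ m, HasDerivAt H (H' m) m) ∧
      (∀ m ≤ 1, G m = 0 ∧ H m = 0) ∧ (∀ X m, 0 ≤ X → X ≤ m → 0 ≤ G m - H m * exp X) ∧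
      ∀ X e m y : ℝ, 0 ≤ m → 0 < e → e ≤ 1 → X = m * e →
        min (X ^ (p - 1)) 1 * exp X - C * m ^ (p - 1) ≤ G m - H m * exp X
          - ((G' m - H' m * exp X) * ((1 + β) * y - β * |y| ^ p)
            - H m * (exp X * ((1 + β) * e * y))) := by
  obtain ⟨A, B, D, κ, hB, hBA, hD, hκ, hκ1, hmain⟩ := exists_moser_supersolution hp hβ h
  obtain ⟨χ, χ', K, hsm, hder, hχ0, hχ'0, hχ1, hχ2, hK⟩ := exists_contDiff_cutoff
  have hA : 0 ≤ A := hB.trans hBA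
  have hK0 : 0 ≤ K := (hχ'0 1).trans (hK 1 (by norm_num))
  have hV0 : ∀ X m, X ≤ m → 0 ≤ A * exp m + D * exp (κ * m) - B * exp X := by
    intro X m hX
    have h1 : B * exp X ≤ A * exp m := by gcongr
    have h2 : 0 ≤ D * exp (κ * m) := by positivity
    linarith
  have hexp : ∀ m, HasDerivAt (fun m => A * exp m + D * exp (κ * m))
      (A * exp m + D * (exp (κ * m) * (κ * 1))) m := fun m =>
    ((Real.hasDerivAt_exp m).const_mul A).add
      ((((hasDerivAt_id m).const_mul κ).exp).const_mul D)
  refine ⟨fun m => χ m * (A * exp m + D * exp (κ * m)),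
    fun m => χ' m * (A * exp m + D * exp (κ * m))
      + χ m * (A * exp m + D * (exp (κ * m) * (κ * 1))),
    fun m => B * χ m, fun m => B * χ' m, exp 2 + K * ((A + D) * exp 2), by positivity,
    hsm.mul (by fun_prop), contDiff_const.mul hsm, fun m => (hder m).mul (hexp m),
    fun m => (hder m).const_mul B, fun m hm => by simp [(hχ1 m hm).1], ?_, ?_⟩
  · intro X m hX hXm
    have := mul_nonneg (hχ0 m) (hV0 X m hXm)
    linarith
  · intro X e m y hm he he1 hX
    have hXm : X ≤ m := by rw [hX]; nlinarith
    have hX0 : 0 ≤ X := by rw [hX]; positivity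
    have hn := youngDefect_nonneg hp.le hβ h y
    have hS := mul_le_mul_of_nonneg_left (hmain X e m y hm he he1 hX) (hχ0 m)
    have hT := mul_nonneg (mul_nonneg (hχ'0 m) (hV0 X m hXm)) hn
    have hid : (1 + β) * y - β * |y| ^ p = 1 - youngDefect p β y := by unfold youngDefect; ring
    rw [hid]
    set n := youngDefect p β y
    suffices hsuff : min (X ^ (p - 1)) 1 * exp X
        - (exp 2 + K * ((A + D) * exp 2)) * m ^ (p - 1)
        ≤ χ m * exp X - χ' m * (A * exp m + D * exp (κ * m) - B * exp X) by
      linarith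
    rcases le_or_gt 2 m with h2 | h2
    · rw [(hχ2 m h2).1, (hχ2 m h2).2]
      have h1 : min (X ^ (p - 1)) 1 * exp X ≤ 1 * exp X := by
        gcongr
        exact min_le_right _ _
      have h3 : 0 ≤ (exp 2 + K * ((A + D) * exp 2)) * m ^ (p - 1) := by positivity
      linarith
    have hlow : min (X ^ (p - 1)) 1 * exp X ≤ m ^ (p - 1) * exp 2 := by
      have : min (X ^ (p - 1)) 1 ≤ m ^ (p - 1) :=
        (min_le_left _ _).trans (rpow_le_rpow hX0 hXm (by linarith))
      have h4 : exp X ≤ exp 2 := exp_le_exp.2 (by linarith)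
      gcongr
    rcases le_or_gt m 1 with h1 | h1
    · rw [(hχ1 m h1).1, (hχ1 m h1).2]
      have h3 : 0 ≤ K * ((A + D) * exp 2) * m ^ (p - 1) := by positivity
      linarith
    · have h3 : 1 ≤ m ^ (p - 1) := one_le_rpow h1.le (by linarith)
      have h4 : A * exp m + D * exp (κ * m) - B * exp X ≤ (A + D) * exp 2 := by
        have h5 : A * exp m ≤ A * exp 2 := by gcongr
        have h6 : D * exp (κ * m) ≤ D * exp 2 := by
          gcongr
          nlinarith
        have h7 : 0 ≤ B * exp X := by positivity
        linarith
      have h5 : χ' m * (A * exp m + D * exp (κ * m) - B * exp X) ≤ K * ((A + D) * exp 2) := by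
        have := hV0 X m hXm
        have := hK m ⟨h1.le, h2.le⟩
        gcongr
      have h6 : K * ((A + D) * exp 2) * 1 ≤ K * ((A + D) * exp 2) * m ^ (p - 1) := by gcongr
      have h7 : 0 ≤ χ m * exp X := mul_nonneg (hχ0 m) (exp_pos X).le
      linarith

/-- The pointwise change of variables behind `exists_intervalIntegral_le`. -/
theorem abs_rpow_logDeriv_eq {p β N μ x w v E : ℝ} (hp : 2 ≤ p) (hβ : 0 < β)
    (h : β * p = 1 + β) (hN : 0 < N) (hμ : 0 ≤ μ) (hx : 0 < x) (hE : 0 < E) :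
    |x / N * μ * (|w| ^ (1 + β - 2) * w) * v * E ^ (-β)| ^ p =
      x / N * (μ * |w| ^ (1 + β)) * E ^ (-β - 1)
        * (N ^ (1 - p) * μ ^ (p - 1) * (x ^ (p - 1) * |v| ^ p)) := by
  have hp0 : p ≠ 0 := by linarith
  have hw : (|w| ^ (1 + β - 2) * |w|) ^ p = |w| ^ (1 + β) := by
    rcases eq_or_ne w 0 with rfl | hw
    · rw [abs_zero, mul_zero, zero_rpow hp0, zero_rpow (by linarith)]
    · have hw' : 0 < |w| := abs_pos.2 hw
      rw [← rpow_add_one hw'.ne', ← rpow_mul hw'.le]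
      congr 1
      linarith
  have hEp : (E ^ (-β)) ^ p = E ^ (-β - 1) := by
    rw [← rpow_mul hE.le]
    congr 1
    linarith
  have hμp : μ ^ p = μ * μ ^ (p - 1) := by
    rcases hμ.eq_or_lt with rfl | hμ
    · rw [zero_rpow hp0, zero_mul]
    · rw [rpow_sub_one hμ.ne']
      field_simp
  rw [abs_mul, abs_mul, abs_mul, abs_mul, abs_mul, abs_of_pos (div_pos hx hN), abs_of_nonneg hμ,
    abs_of_pos (rpow_pos_of_pos hE _), abs_of_nonneg (rpow_nonneg (abs_nonneg w) _),
    mul_rpow (by positivity) (by positivity), mul_rpow (by positivity) (by positivity),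
    mul_rpow (by positivity) (by positivity), mul_rpow (by positivity) (by positivity), hw, hEp,
    hμp, div_rpow hx.le hN.le, rpow_sub_one hx.ne', rpow_sub hN, Real.rpow_one]
  field_simp

theorem ContinuousOn.intervalIntegrable_abs_rpow_mul_rpow {w : ℝ → ℝ} {a b p θ : ℝ}
    (hw : ContinuousOn w (Set.uIcc a b)) (hp : 0 ≤ p) (hθ : 0 ≤ θ) :
    IntervalIntegrable (fun r => |w r| ^ p * r ^ θ) volume a b :=
  ((hw.abs.rpow_const fun _ _ => Or.inr hp).mul
    (continuousOn_id.rpow_const fun _ _ => Or.inr hθ)).intervalIntegrable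

theorem ContinuousOn.intervalIntegrable_min_rpow_mul_exp {w : ℝ → ℝ} {a b p q θ : ℝ}
    (hw : ContinuousOn w (Set.uIcc a b)) (hp : 0 ≤ p - 1) (hθ : 0 ≤ θ) (hq : 0 ≤ q) (μ : ℝ) :
    IntervalIntegrable (fun r => min ((μ * |w r| ^ q) ^ (p - 1)) 1 * exp (μ * |w r| ^ q) * r ^ θ)
      volume a b := by
  have hX : ContinuousOn (fun r => μ * |w r| ^ q) (Set.uIcc a b) :=
    continuousOn_const.mul (hw.abs.rpow_const fun _ _ => Or.inr hq)
  exact ((((hX.rpow_const fun _ _ => Or.inr hp).inf continuousOn_const).mul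
    (continuous_exp.comp_continuousOn hX)).mul
    (continuousOn_id.rpow_const fun _ _ => Or.inr hθ)).intervalIntegrable

theorem exists_intervalIntegral_le {p β θ : ℝ} (hp : 2 ≤ p) (hβ : 0 < β) (h : β * p = 1 + β)
    (hθ : 0 ≤ θ) :
    ∃ C : ℝ, 0 < C ∧ ∀ (w u' : ℝ → ℝ) (a b μ η : ℝ), 0 < a → a ≤ b →
      AbsolutelyContinuousOnInterval w a b →
      (∀ᵐ x, x ∈ Set.Icc a b → HasDerivAt w (u' x) x) →
      IntervalIntegrable (fun r => r ^ (p - 1) * |u' r| ^ p) volume a b → 0 ≤ μ → 0 < η →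
      (θ + 1) ^ (1 - p) * μ ^ (p - 1) * (∫ r in a..b, r ^ (p - 1) * |u' r| ^ p) ≤ 1 - η →
      μ * |w b| ^ (1 + β) ≤ η ^ β →
      ∫ r in a..b, min ((μ * |w r| ^ (1 + β)) ^ (p - 1)) 1 * exp (μ * |w r| ^ (1 + β)) * r ^ θ
        ≤ C * μ ^ (p - 1) / η * ∫ r in a..b, |w r| ^ p * r ^ θ := by
  obtain ⟨G, G', H, H', C, hC, hGs, hHs, hG, hH, hvan, hpos, hsup⟩ :=
    exists_cutoff_moser_supersolution (p := p) (by linarith) hβ h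
  refine ⟨C, hC, fun w u' a b μ η ha hab hw hw' hρ hμ hη hen hwb => ?_⟩
  set N := θ + 1 with hN
  have hN0 : 0 < N := by linarith
  set ρ : ℝ → ℝ := fun r => r ^ (p - 1) * |u' r| ^ p with hρdef
  set D : ℝ := N ^ (1 - p) * μ ^ (p - 1) with hD
  have hD0 : 0 ≤ D := by positivity
  set J : ℝ → ℝ := fun x => ∫ r in a..x, ρ r with hJ
  set E : ℝ → ℝ := fun x => 1 - D * J x with hE
  set X : ℝ → ℝ := fun x => μ * |w x| ^ (1 + β) with hX
  set P : ℝ → ℝ := fun x => E x ^ (-β) with hP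
  set F : ℝ → ℝ := fun x => x ^ N * (G (X x * P x) - H (X x * P x) * exp (X x)) with hF
  have hbase : 1 < 1 + β := by linarith
  have hρ0 : ∀ r, 0 < r → 0 ≤ ρ r := fun r hr => by positivity
  have hJ0 : ∀ x ∈ Set.Icc a b, 0 ≤ J x ∧ J x ≤ J b := by
    intro x hx
    refine ⟨intervalIntegral.integral_nonneg hx.1 fun r hr => hρ0 r (ha.trans_le hr.1), ?_⟩
    refine intervalIntegral.integral_mono_interval le_rfl hx.1 hx.2 ?_ hρ
    rw [EventuallyLE, ae_restrict_iff' measurableSet_Ioc]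
    exact Eventually.of_forall fun r hr => hρ0 r (ha.trans hr.1)
  have hE0 : ∀ x ∈ Set.Icc a b, η ≤ E x ∧ E x ≤ 1 := by
    intro x hx
    have h1 := mul_le_mul_of_nonneg_left (hJ0 x hx).2 hD0
    have h2 := mul_nonneg hD0 (hJ0 x hx).1
    simp only [hE]
    constructor <;> linarith
  have hη1 : η ≤ 1 := (hE0 a ⟨le_rfl, hab⟩).1.trans (hE0 a ⟨le_rfl, hab⟩).2
  have hX0 : ∀ x, 0 ≤ X x := fun x => by positivity
  have hP1 : ∀ x ∈ Set.Icc a b, 1 ≤ P x := fun x hx =>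
    one_le_rpow_of_pos_of_le_one_of_nonpos (hη.trans_le (hE0 x hx).1) (hE0 x hx).2 (by linarith)
  have hXP : ∀ x ∈ Set.Icc a b, X x ≤ X x * P x := fun x hx =>
    le_mul_of_one_le_right (hX0 x) (hP1 x hx)
  have huIcc : Set.uIcc a b = Set.Icc a b := Set.uIcc_of_le hab
  have hJac : AbsolutelyContinuousOnInterval J a b :=
    hρ.absolutelyContinuousOnInterval_intervalIntegral (by simp)
  have hEac : AbsolutelyContinuousOnInterval E a b :=
    hJac.comp_contDiff (g := fun j => 1 - D * j) (by fun_prop)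
  have hXac : AbsolutelyContinuousOnInterval X a b :=
    hw.comp_contDiff (g := fun t => μ * |t| ^ (1 + β))
      (contDiff_const.mul (contDiff_norm_rpow (E := ℝ) hbase))
  have hPac : AbsolutelyContinuousOnInterval P a b :=
    hEac.comp_contDiffOn (g := fun t => t ^ (-β)) (c := η) (d := 1)
      (fun t ht => (contDiffAt_rpow_const_of_ne (hη.trans_le ht.1).ne').contDiffWithinAt)
      (fun x hx => hE0 x (huIcc ▸ hx))
  have hmac : AbsolutelyContinuousOnInterval (fun x => X x * P x) a b := hXac.fun_mul hPac
  have hFac : AbsolutelyContinuousOnInterval F a b := by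
    refine AbsolutelyContinuousOnInterval.fun_mul ?_ (((hmac.comp_contDiff hGs).fun_sub
      ((hmac.comp_contDiff hHs).fun_mul (hXac.comp_contDiff contDiff_exp))))
    refine ContDiffOn.absolutelyContinuousOnInterval fun t ht => ?_
    rw [huIcc] at ht
    exact (contDiffAt_rpow_const_of_ne (ha.trans_le ht.1).ne').contDiffWithinAt
  have hwc : ContinuousOn w (Set.uIcc a b) := hw.continuousOn
  have hi1 : IntervalIntegrable (fun r => min (X r ^ (p - 1)) 1 * exp (X r) * r ^ θ) volume a b :=
    hwc.intervalIntegrable_min_rpow_mul_exp (by linarith) hθ (by linarith) μ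
  have hi2 : IntervalIntegrable (fun r => |w r| ^ p * r ^ θ) volume a b :=
    hwc.intervalIntegrable_abs_rpow_mul_rpow (by linarith) hθ
  have hmain : ∫ x in a..b, (N * (min (X x ^ (p - 1)) 1 * exp (X x) * x ^ θ)
      - N * (C * μ ^ (p - 1) / η) * (|w x| ^ p * x ^ θ)) ≤ F b - F a := by
    refine hFac.integral_le_sub hab ((hi1.const_mul _).sub (hi2.const_mul _)) ?_
    filter_upwards [hw', hρ.ae_hasDerivAt_integral] with x hwx hJx hx
    have hx0 : 0 < x := ha.trans_le hx.1
    have hEx := hη.trans_le (hE0 x hx).1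
    have dw := hwx hx
    have dJ : HasDerivAt J (ρ x) x := hJx (huIcc ▸ hx) a (by simp)
    have dE : HasDerivAt E (-(D * ρ x)) x := (dJ.const_mul D).const_sub 1
    have dX : HasDerivAt X (μ * ((1 + β) * |w x| ^ (1 + β - 2) * w x * u' x)) x :=
      ((hasDerivAt_abs_rpow (w x) hbase).comp x dw).const_mul μ
    have dP : HasDerivAt P (-(D * ρ x) * -β * E x ^ (-β - 1)) x :=
      dE.rpow_const (Or.inl hEx.ne')
    have dm := dX.mul dP
    have dN : HasDerivAt (fun x : ℝ => x ^ N) (N * x ^ (N - 1)) x :=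
      hasDerivAt_rpow_const (Or.inl hx0.ne')
    have dF := dN.mul (((hG _).comp x dm).sub (((hH _).comp x dm).mul dX.exp))
    refine ⟨_, dF, ?_⟩
    set y : ℝ := -(x / N * μ * (|w x| ^ (1 + β - 2) * w x) * u' x * E x ^ (-β)) with hy
    have hPe : P x * E x ^ β = 1 := by
      rw [show P _ = E _ ^ (-β) from rfl, rpow_neg hEx.le, inv_mul_cancel₀ (rpow_pos_of_pos hEx _).ne']
    have hs := hsup (X x) (E x ^ β) (X x * P x) y ((hX0 x).trans (hXP x hx))
      (rpow_pos_of_pos hEx _) (rpow_le_one hEx.le (hE0 x hx).2 hβ.le)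
      (by rw [mul_assoc, hPe, mul_one])
    have hyp : |y| ^ p = x / N * X x * E x ^ (-β - 1) * (D * ρ x) := by
      rw [hy, abs_neg, abs_rpow_logDeriv_eq hp hβ h hN0 hμ hx0 hEx]
    have hmX : (X x * P x) ^ (p - 1) ≤ μ ^ (p - 1) / η * |w x| ^ p := by
      have h1 : X x ^ (p - 1) = μ ^ (p - 1) * |w x| ^ p := by
        rw [hX, mul_rpow hμ (by positivity), ← rpow_mul (abs_nonneg _)]
        congr 2
        linarith
      have h2 : P x ^ (p - 1) = (E x)⁻¹ := by
        rw [show P _ = E _ ^ (-β) from rfl, ← rpow_mul hEx.le, ← Real.rpow_neg_one]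
        congr 1
        linarith
      rw [mul_rpow (hX0 x) (zero_le_one.trans (hP1 x hx)), h1, h2]
      have h3 : (E x)⁻¹ ≤ η⁻¹ := inv_anti₀ hη (hE0 x hx).1
      calc μ ^ (p - 1) * |w x| ^ p * (E x)⁻¹ ≤ μ ^ (p - 1) * |w x| ^ p * η⁻¹ := by gcongr
        _ = _ := by ring
    have hx1 : x ^ N = x * x ^ θ := by rw [hN, rpow_add_one hx0.ne', mul_comm]
    have hx2 : x ^ (N - 1) = x ^ θ := by rw [hN, add_sub_cancel_right]
    have hXd : μ * ((1 + β) * |w x| ^ (1 + β - 2) * w x * u' x)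
        = -(N / x) * ((1 + β) * E x ^ β * y) := by
      have : (1 + β) * E x ^ β * y = -(x / N) * μ * (1 + β) * (|w x| ^ (1 + β - 2) * w x) * u' x
          * (P x * E x ^ β) := by rw [hy]; ring
      rw [this, hPe]
      field_simp
    have hmd : μ * ((1 + β) * |w x| ^ (1 + β - 2) * w x * u' x) * P x
        + X x * (-(D * ρ x) * -β * E x ^ (-β - 1))
        = -(N / x) * ((1 + β) * y - β * |y| ^ p) := by
      rw [hyp, hy]
      field_simp
      ring
    have hfin := mul_le_mul_of_nonneg_left hs (by positivity : 0 ≤ N * x ^ θ)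
    have hfin2 := mul_le_mul_of_nonneg_left (mul_le_mul_of_nonneg_left hmX hC.le)
      (by positivity : 0 ≤ N * x ^ θ)
    simp only [Function.comp_apply, Pi.sub_apply, Pi.mul_apply]
    rw [hmd, hXd, hx1, hx2]
    refine le_trans (le_of_eq_of_le ?_ (sub_le_sub_left hfin2
      (N * x ^ θ * (min (X x ^ (p - 1)) 1 * exp (X x))))) ?_
    · ring
    · rw [← mul_sub]
      refine hfin.trans (le_of_eq ?_)
      field_simp
      ring
  have hFb : F b = 0 := by
    have hb : b ∈ Set.Icc a b := ⟨hab, le_rfl⟩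
    have hEb := hη.trans_le (hE0 b hb).1
    have : X b * P b ≤ 1 := by
      have h1 : η ^ β ≤ E b ^ β := rpow_le_rpow hη.le (hE0 b hb).1 hβ.le
      have h2 : X b ≤ E b ^ β := hwb.trans h1
      rw [show P _ = E _ ^ (-β) from rfl, rpow_neg hEb.le, ← div_eq_mul_inv]
      exact div_le_one_of_le₀ h2 (by positivity)
    simp only [hF, (hvan _ this).1, (hvan _ this).2]
    ring
  have hFa : 0 ≤ F a := by
    have haa : a ∈ Set.Icc a b := ⟨le_rfl, hab⟩
    exact mul_nonneg (by positivity) (hpos _ _ (hX0 a) (hXP a haa))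
  rw [intervalIntegral.integral_sub (hi1.const_mul _) (hi2.const_mul _),
    intervalIntegral.integral_const_mul, intervalIntegral.integral_const_mul, mul_assoc,
    ← mul_sub] at hmain
  have := nonpos_of_mul_nonpos_right (hmain.trans (by linarith)) hN0
  linarith

theorem omegaW_pos {θ : ℝ} (hθ : 0 ≤ θ) : 0 < omegaW θ := by
  have := Real.Gamma_pos_of_pos (by linarith : 0 < (θ + 1) / 2)
  unfold omegaW
  positivity

theorem muC_pos {α θ : ℝ} (hα : 0 ≤ α) (hθ : 0 ≤ θ) : 0 < muC α θ := by
  have := omegaW_pos hα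
  unfold muC
  positivity

theorem muC_rpow {α θ : ℝ} (hα : 0 < α) (hθ : 0 ≤ θ) :
    muC α θ ^ α = (θ + 1) ^ α * omegaW α := by
  have := omegaW_pos hα.le
  rw [muC, mul_rpow (by linarith) (by positivity), ← rpow_mul this.le, one_div_mul_cancel hα.ne',
    Real.rpow_one]

theorem phiP_le {p t : ℝ} (hp : 1 ≤ p) (ht : 0 ≤ t) :
    phiP p t ≤ exp 1 * (min (t ^ (p - 1)) 1 * exp t) := by
  have hexp : ∀ x : ℝ, HasSum (fun j : ℕ => x ^ j / (Nat.factorial j : ℝ)) (exp x) := fun x => by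
    rw [Real.exp_eq_exp_ℝ]
    exact NormedSpace.expSeries_div_hasSum_exp x
  have hs : Summable fun j : ℕ => if p - 1 ≤ (j : ℝ) then t ^ j / (Nat.factorial j : ℝ) else 0 :=
    Summable.of_nonneg_of_le (fun j => by split_ifs <;> positivity)
      (fun j => by split_ifs; exacts [le_rfl, by positivity]) (hexp t).summable
  rcases le_total t 1 with h1 | h1
  · have hle : phiP p t ≤ t ^ (p - 1) * exp 1 := by
      refine hasSum_le (fun j => ?_) hs.hasSum ((hexp 1).mul_left (t ^ (p - 1)))
      split_ifs with hj
      · rw [one_pow, mul_one_div]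
        gcongr
        rw [← Real.rpow_natCast]
        exact rpow_le_rpow_of_exponent_ge_of_imp ht h1 hj fun _ h => by
          linarith
      · positivity
    rw [min_eq_left (rpow_le_one ht h1 (by linarith))]
    have h2 : t ^ (p - 1) * exp 1 * 1 ≤ t ^ (p - 1) * exp 1 * exp t := by
      gcongr
      exact one_le_exp ht
    linarith
  · have hle : phiP p t ≤ exp t := by
      refine hasSum_le (fun j => ?_) hs.hasSum (hexp t)
      split_ifs
      exacts [le_rfl, by positivity]
    rw [min_eq_right (Real.one_le_rpow h1 (by linarith)), one_mul]
    exact hle.trans (le_mul_of_one_le_left (exp_pos t).le (one_le_exp zero_le_one))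

theorem wNorm_rpow {θ q : ℝ} (hq : q ≠ 0) (u : ℝ → ℝ) :
    wNorm θ q u ^ q = wInt θ fun r => |u r| ^ q := by
  rw [wNorm, ← ENNReal.rpow_mul, one_div_mul_cancel hq, ENNReal.rpow_one]

/-- The gradient constraint in terms of ordinary integrals over compact subintervals. -/
theorem intervalIntegrable_and_integral_le_of_wNorm_le_one {p α a b : ℝ} {u' : ℝ → ℝ} (hp : 0 < p)
    (hα : 0 ≤ α) (ha : 0 < a) (hab : a ≤ b) (hu' : IntervalIntegrable u' volume a b)
    (h : wNorm α p u' ≤ 1) :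
    IntervalIntegrable (fun r => r ^ α * |u' r| ^ p) volume a b ∧
      ∫ r in a..b, r ^ α * |u' r| ^ p ≤ (omegaW α)⁻¹ := by
  have hω := omegaW_pos hα
  have h1 : wInt α (fun r => |u' r| ^ p) ≤ 1 := by
    rw [← wNorm_rpow hp.ne']
    exact ENNReal.rpow_le_one h hp.le
  have h2 : ∫⁻ r in Set.Ioc a b, ENNReal.ofReal (r ^ α * |u' r| ^ p)
      ≤ ENNReal.ofReal (omegaW α)⁻¹ := by
    rw [ENNReal.ofReal_inv_of_pos hω, ENNReal.le_inv_iff_mul_le, mul_comm]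
    refine le_trans ?_ h1
    unfold wInt
    gcongr ENNReal.ofReal _ * ?_
    refine (lintegral_mono_set fun r hr => ha.trans hr.1).trans'
      (setLIntegral_mono' measurableSet_Ioc fun r hr => ?_)
    rw [mul_comm, ENNReal.ofReal_mul (by positivity)]
  have hmeas : AEStronglyMeasurable (fun r => r ^ α * |u' r| ^ p)
      (volume.restrict (Set.Ioc a b)) := by
    have h3 : AEMeasurable u' (volume.restrict (Set.Ioc a b)) := hu'.1.aestronglyMeasurable.aemeasurable
    have h4 : AEMeasurable (fun r => |u' r|) (volume.restrict (Set.Ioc a b)) := h3.norm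
    exact ((measurable_id.pow_const α).aemeasurable.mul (h4.pow_const p)).aestronglyMeasurable
  have hnn : 0 ≤ᵐ[volume.restrict (Set.Ioc a b)] fun r => r ^ α * |u' r| ^ p := by
    rw [EventuallyLE, ae_restrict_iff' measurableSet_Ioc]
    refine Eventually.of_forall fun r hr => ?_
    have := ha.trans hr.1
    simp only [Pi.zero_apply]
    positivity
  refine ⟨?_, ?_⟩
  · rw [intervalIntegrable_iff_integrableOn_Ioc_of_le hab]
    exact ⟨hmeas, (hasFiniteIntegral_iff_ofReal hnn).2 (h2.trans_lt ENNReal.ofReal_lt_top)⟩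
  · rw [intervalIntegral.integral_of_le hab, integral_eq_lintegral_of_nonneg_ae hnn hmeas]
    exact ENNReal.toReal_le_of_le_ofReal (by positivity) h2

theorem MemX.absolutelyContinuousOnInterval {p α θ a b : ℝ} {u u' : ℝ → ℝ}
    (hu : MemX p α θ u u') (ha : 0 < a) (hab : a ≤ b) :
    ∃ w : ℝ → ℝ, Set.EqOn w u (Set.Icc a b) ∧ AbsolutelyContinuousOnInterval w a b ∧
      ∀ᵐ x, x ∈ Set.Icc a b → HasDerivAt w (u' x) x := by
  have hint := hu.ftc_int a b ha hab
  refine ⟨fun x => u a + ∫ t in a..x, u' t, fun x hx => ?_, ?_, ?_⟩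
  · have := hu.ftc a x ha hx.1
    simp only
    linarith
  · exact (hint.absolutelyContinuousOnInterval_intervalIntegral (by simp)).comp_contDiff
      (g := fun s => u a + s) (by fun_prop)
  · filter_upwards [hint.ae_hasDerivAt_integral] with x hx hmem
    exact (hx (Set.uIcc_of_le hab ▸ hmem) a (by simp)).const_add _

theorem exists_TMfunc_le {p α θ : ℝ} (hp : 2 ≤ p) (hα : α = p - 1) (hθ : 0 ≤ θ) :
    ∃ C : ℝ, 0 < C ∧ ∀ (μ : ℝ) (u u' : ℝ → ℝ), 0 ≤ μ → μ < muC α θ → MemX p α θ u u' →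
      wNorm α p u' ≤ 1 →
      TMfunc p θ μ u ≤ ENNReal.ofReal (C / (1 - (μ / muC α θ) ^ (p - 1)))
        * wInt θ fun r => |u r| ^ p := by
  have hp1 : 0 < p - 1 := by linarith
  have hα0 : 0 < α := by linarith
  set β : ℝ := 1 / (p - 1) with hβdef
  have hβ : 0 < β := by positivity
  have hβp : β * p = 1 + β := by rw [hβdef]; field_simp; ring
  have hq : p / (p - 1) = 1 + β := by rw [← hβp, hβdef]; ring
  obtain ⟨C, hC, hmain⟩ := exists_intervalIntegral_le hp hβ hβp hθ
  have hM := muC_pos hα0.le hθ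
  have hω := omegaW_pos hα0.le
  refine ⟨exp 1 * C * muC α θ ^ (p - 1), by positivity, fun μ u u' hμ hμM hu hgrad => ?_⟩
  set s := (μ / muC α θ) ^ (p - 1) with hs
  have hs1 : s < 1 := rpow_lt_one (by positivity) ((div_lt_one hM).2 hμM) hp1
  have hη : 0 < 1 - s := by linarith
  obtain ⟨b₀, hb₀⟩ : ∃ b₀ : ℝ, ∀ b, b₀ ≤ b → μ * |u b| ^ (1 + β) ≤ (1 - s) ^ β := by
    have hlim : Tendsto (fun b => μ * |u b| ^ (1 + β)) atTop (nhds (μ * |0| ^ (1 + β))) :=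
      ((hu.lim_zero.abs).rpow_const (Or.inr (by linarith))).const_mul μ
    rw [abs_zero, zero_rpow (by linarith), mul_zero] at hlim
    exact eventually_atTop.1 (hlim.eventually_le_const (rpow_pos_of_pos hη β))
  have hlocal : ∀ a b : ℝ, 0 < a → a ≤ b → b₀ ≤ b →
      ∫⁻ r in Set.Ioc a b, ENNReal.ofReal (phiP p (μ * |u r| ^ (p / (p - 1))))
        * ENNReal.ofReal (r ^ θ)
      ≤ ENNReal.ofReal (exp 1 * C * muC α θ ^ (p - 1) / (1 - s)) *
        ∫⁻ r in Set.Ioi (0 : ℝ), ENNReal.ofReal (|u r| ^ p) * ENNReal.ofReal (r ^ θ) := by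
    intro a b ha hab hb
    obtain ⟨w, hwu, hwac, hwd⟩ := hu.absolutelyContinuousOnInterval ha hab
    obtain ⟨hint, hle⟩ := intervalIntegrable_and_integral_le_of_wNorm_le_one (by linarith) hα0.le
      ha hab (hu.ftc_int a b ha hab) hgrad
    rw [hα] at hint hle
    have hen : (θ + 1) ^ (1 - p) * μ ^ (p - 1) * (∫ r in a..b, r ^ (p - 1) * |u' r| ^ p)
        ≤ 1 - (1 - s) := by
      refine (mul_le_mul_of_nonneg_left hle (by positivity)).trans (le_of_eq ?_)
      have hmu := muC_rpow hα0 hθ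
      rw [hα] at hmu
      rw [hs, hα, div_rpow hμ (hα ▸ hM).le, hmu, show 1 - p = -(p - 1) by ring,
        Real.rpow_neg (by linarith)]
      field_simp
      ring
    have hb' := hmain w u' a b μ (1 - s) ha hab hwac hwd hint hμ hη hen
      (by rw [hwu ⟨hab, le_rfl⟩]; exact hb₀ b hb)
    have hi1 := hwac.continuousOn.intervalIntegrable_min_rpow_mul_exp (p := p) (q := 1 + β)
      hp1.le hθ (by linarith) μ
    have hi2 := hwac.continuousOn.intervalIntegrable_abs_rpow_mul_rpow (p := p) (by linarith) hθ
    rw [intervalIntegrable_iff_integrableOn_Ioc_of_le hab] at hi1 hi2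
    rw [intervalIntegral.integral_of_le hab, intervalIntegral.integral_of_le hab] at hb'
    have hpos : ∀ r ∈ Set.Ioc a b, 0 < r := fun r hr => ha.trans hr.1
    calc ∫⁻ r in Set.Ioc a b, ENNReal.ofReal (phiP p (μ * |u r| ^ (p / (p - 1))))
          * ENNReal.ofReal (r ^ θ)
        ≤ ∫⁻ r in Set.Ioc a b, ENNReal.ofReal (exp 1)
          * ENNReal.ofReal (min ((μ * |w r| ^ (1 + β)) ^ (p - 1)) 1
            * exp (μ * |w r| ^ (1 + β)) * r ^ θ) := by
          refine setLIntegral_mono' measurableSet_Ioc fun r hr => ?_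
          have hr0 := hpos r hr
          rw [hwu (Set.Ioc_subset_Icc_self hr), hq, ← ENNReal.ofReal_mul' (by positivity),
            ← ENNReal.ofReal_mul (by positivity)]
          refine ENNReal.ofReal_le_ofReal ?_
          rw [← mul_assoc]
          gcongr
          exact phiP_le (by linarith) (by positivity)
      _ = ENNReal.ofReal (exp 1) * ENNReal.ofReal (∫ r in Set.Ioc a b,
            min ((μ * |w r| ^ (1 + β)) ^ (p - 1)) 1 * exp (μ * |w r| ^ (1 + β)) * r ^ θ) := by
          rw [lintegral_const_mul' _ _ ENNReal.ofReal_ne_top,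
            ofReal_integral_eq_lintegral_ofReal hi1]
          rw [EventuallyLE, ae_restrict_iff' measurableSet_Ioc]
          refine Eventually.of_forall fun r hr => ?_
          have hr0 := hpos r hr
          simp only [Pi.zero_apply]
          positivity
      _ ≤ ENNReal.ofReal (exp 1) * ENNReal.ofReal (C * μ ^ (p - 1) / (1 - s)
            * ∫ r in Set.Ioc a b, |w r| ^ p * r ^ θ) := by
          gcongr
      _ = ENNReal.ofReal (exp 1 * (C * μ ^ (p - 1) / (1 - s))) *
            ∫⁻ r in Set.Ioc a b, ENNReal.ofReal (|w r| ^ p * r ^ θ) := by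
          rw [ENNReal.ofReal_mul (by positivity : 0 ≤ C * μ ^ (p - 1) / (1 - s)),
            ENNReal.ofReal_mul (by positivity : 0 ≤ exp 1), mul_assoc,
            ofReal_integral_eq_lintegral_ofReal hi2]
          rw [EventuallyLE, ae_restrict_iff' measurableSet_Ioc]
          refine Eventually.of_forall fun r hr => ?_
          have hr0 := hpos r hr
          simp only [Pi.zero_apply]
          positivity
      _ ≤ _ := by
          refine mul_le_mul' (ENNReal.ofReal_le_ofReal ?_) ?_
          · rw [mul_div_assoc', mul_assoc]
            gcongr
          · refine (lintegral_mono_set fun r hr => hpos r hr).trans'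
              (setLIntegral_mono' measurableSet_Ioc fun r hr => ?_)
            rw [hwu (Set.Ioc_subset_Icc_self hr), ENNReal.ofReal_mul (by positivity)]
  unfold TMfunc wInt
  rw [mul_left_comm]
  gcongr ENNReal.ofReal _ * ?_
  set I : ℕ → Set ℝ := fun n => Set.Ioc (1 / ((n : ℝ) + 1)) (max 1 b₀ + n) with hI
  have hmono : Monotone I := fun m n hmn => by
    have : (m : ℝ) ≤ n := by exact_mod_cast hmn
    exact Set.Ioc_subset_Ioc (one_div_le_one_div_of_le (by positivity) (by linarith))
      (by linarith)
  have hU : Set.Ioi (0 : ℝ) = ⋃ n, I n := by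
    ext r
    simp only [Set.mem_Ioi, Set.mem_iUnion]
    constructor
    · intro hr
      obtain ⟨n, hn⟩ := exists_nat_one_div_lt hr
      obtain ⟨k, hk⟩ := exists_nat_ge r
      have hnk : (1 : ℝ) / ((max n k : ℕ) + 1) ≤ 1 / (n + 1) := by
        gcongr
        exact le_max_left n k
      have hkn : (k : ℝ) ≤ (max n k : ℕ) := by
        exact_mod_cast le_max_right n k
      exact ⟨max n k, hnk.trans_lt hn, by linarith [le_max_left 1 b₀]⟩
    · rintro ⟨n, hn⟩
      exact lt_trans (by positivity) hn.1
  rw [hU, setLIntegral_iUnion_of_directed _ hmono.directed_le, ← hU]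
  refine iSup_le fun n => hlocal _ _ (by positivity) ?_ ?_
  · have h1 : 1 / ((n : ℝ) + 1) ≤ 1 := by
      rw [div_le_one (by positivity)]
      linarith [n.cast_nonneg (α := ℝ)]
    linarith [le_max_left 1 b₀, n.cast_nonneg (α := ℝ)]
  · linarith [le_max_right 1 b₀, n.cast_nonneg (α := ℝ)]

theorem stmt_0 (p α θ : ℝ) (hp : 2 ≤ p) (hα : α = p - 1) (hθ : 0 ≤ θ) :
    ∃ C : ℝ, 0 < C ∧ ∀ μ : ℝ, 0 ≤ μ → μ < muC α θ →
      TMSC p α θ μ ≤ ENNReal.ofReal (C / (1 - (μ / muC α θ) ^ (p - 1))) := by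
  obtain ⟨C, hC, h⟩ := exists_TMfunc_le hp hα hθ
  refine ⟨C, hC, fun μ hμ hμM => ?_⟩
  refine iSup_le fun u => iSup_le fun u' => iSup_le fun hu => iSup_le fun _ => iSup_le fun hgrad => ?_
  have hp0 : p ≠ 0 := by linarith
  have hle := h μ u u' hμ hμM hu hgrad
  have hfin : wInt θ (fun r => |u r| ^ p) ≠ ⊤ := by
    rw [← wNorm_rpow hp0]
    exact (ENNReal.rpow_lt_top_of_nonneg (by linarith) hu.fin_u.ne).ne
  rw [ENNReal.rpow_neg, wNorm_rpow hp0]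
  rcases eq_or_ne (wInt θ fun r => |u r| ^ p) 0 with h0 | h0
  · rw [h0, mul_zero] at hle
    rw [nonpos_iff_eq_zero.1 hle, mul_zero]
    exact zero_le
  · rw [mul_comm, ← div_eq_mul_inv]
    exact ENNReal.div_le_of_le_mul hle
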